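/- arXiv:2407.05215 — 2 statements merged into one kernel-verified Lean document; each statement's English description precedes it below -/
import Mathlib

section
/- Let V, u0 : ℝ → ℝ, let E0, A : ℝ with A ≠ 0, and suppose u0 is twice differentiable with u0''(x) = (V(x) − E0)·u0(x) for all x (i.e., u0 is a zero mode of the Schrödinger operator −d²/dx² + (V − E0)), and u0(x) > 0 for all x. Let ū : ℝ → ℝ be differentiable with ū'(x) = A·u0(x) for all x, and let F : ℝ → ℝ be a function that is differentiable at ū(x) for every x and satisfies F(ū(x)) = A·u0'(x) for all x. Then the derivative of F satisfies F'(ū(x)) = V(x) − E0 for all x ∈ ℝ. -/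
/-- Inverse linearization key identity: if `u0` is a positive zero mode of the
Schrödinger operator `-d²/dx² + (V - E0)`, `ubar' = A·u0`, and `F(ubar(x)) = A·u0'(x)`,
then `F'(ubar(x)) = V(x) - E0`. -/
theorem stmt_0 (V u0 ubar F : ℝ → ℝ) (E0 A : ℝ) (hA : A ≠ 0)
    (hu0 : ∀ x, HasDerivAt u0 (deriv u0 x) x)
    (hu0'' : ∀ x, HasDerivAt (deriv u0) ((V x - E0) * u0 x) x)
    (hpos : ∀ x, 0 < u0 x)
    (hubar : ∀ x, HasDerivAt ubar (A * u0 x) x)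
    (hFdiff : ∀ x, DifferentiableAt ℝ F (ubar x))
    (hF : ∀ x, F (ubar x) = A * deriv u0 x) :
    ∀ x, deriv F (ubar x) = V x - E0 := by
  intro x
  have hcomp : HasDerivAt (fun y => F (ubar y)) (deriv F (ubar x) * (A * u0 x)) x :=
    (hFdiff x).hasDerivAt.comp x (hubar x)
  rw [funext hF] at hcomp
  have heq := hcomp.unique ((hu0'' x).const_mul A)
  refine mul_right_cancel₀ (mul_ne_zero hA (hpos x).ne') (heq.trans ?_)
  ring
end

section
/- Let F : ℝ → ℝ be continuously differentiable (or locally Lipschitz), let ū : ℝ → ℝ be twice differentiable with ū''(x) = F(ū(x)) for all x ∈ ℝ, and suppose a, b ∈ ℝ with a ≠ b satisfy ū'(a) = 0 and ū'(b) = 0. Then ū is periodic with period 2(b − a): ū(x + 2(b − a)) = ū(x) for all x ∈ ℝ. -/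
open Set in
/-- Two global solutions of an autonomous ODE with locally Lipschitz vector field that agree at
one time are equal. -/
theorem LocallyLipschitz.eq_of_hasDerivAt {E : Type*} [NormedAddCommGroup E] [NormedSpace ℝ E]
    {v : E → E} (hv : LocallyLipschitz v) {f g : ℝ → E} {t₀ : ℝ}
    (hf : ∀ t, HasDerivAt f (v (f t)) t) (hg : ∀ t, HasDerivAt g (v (g t)) t)
    (heq : f t₀ = g t₀) : f = g := by
  ext t
  obtain ⟨A, B, ht, ht₀⟩ : ∃ A B, t ∈ Ioo A B ∧ t₀ ∈ Ioo A B :=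
    ⟨min t t₀ - 1, max t t₀ + 1, by grind, by grind⟩
  have hfc : Continuous f := continuous_iff_continuousAt.2 fun t ↦ (hf t).continuousAt
  have hgc : Continuous g := continuous_iff_continuousAt.2 fun t ↦ (hg t).continuousAt
  obtain ⟨K, hK⟩ := hv.locallyLipschitzOn.exists_lipschitzOnWith_of_compact
    ((isCompact_Icc.image hfc).union (isCompact_Icc.image hgc) :
      IsCompact (f '' Icc A B ∪ g '' Icc A B))
  exact ODE_solution_unique_of_mem_Ioo (v := fun _ ↦ v) (fun _ _ ↦ hK) ht₀
    (fun s hs ↦ ⟨hf s, .inl ⟨s, Ioo_subset_Icc_self hs, rfl⟩⟩)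
    (fun s hs ↦ ⟨hg s, .inr ⟨s, Ioo_subset_Icc_self hs, rfl⟩⟩) heq ht

/-- A solution of `u'' = F(u)` is symmetric about each of its critical points. -/
theorem reflection_eq_of_deriv_eq_zero {F u : ℝ → ℝ} (hF : LocallyLipschitz F)
    (h1 : Differentiable ℝ u) (h2 : Differentiable ℝ (deriv u))
    (hode : ∀ x, deriv (deriv u) x = F (u x)) {c : ℝ} (hc : deriv u c = 0) (x : ℝ) :
    u (2 * c - x) = u x := by
  have hv : LocallyLipschitz fun p : ℝ × ℝ ↦ (p.2, F p.1) :=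
    LipschitzWith.prod_snd.locallyLipschitz.prodMk
      (hF.comp LipschitzWith.prod_fst.locallyLipschitz)
  have hd1 (t : ℝ) : HasDerivAt u (deriv u t) t := (h1 t).hasDerivAt
  have hd2 (t : ℝ) : HasDerivAt (deriv u) (F (u t)) t := hode t ▸ (h2 t).hasDerivAt
  have key : (fun t ↦ (u (2 * c - t), -deriv u (2 * c - t))) = fun t ↦ (u t, deriv u t) := by
    refine hv.eq_of_hasDerivAt (t₀ := c) (fun t ↦ ?_) (fun t ↦ (hd1 t).prodMk (hd2 t)) ?_
    · exact ((hd1 _).comp_const_sub (2 * c) t).prodMk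
        (by simpa using ((hd2 _).comp_const_sub (2 * c) t).fun_neg)
    · simp [show 2 * c - c = c by ring, hc]
  exact congrArg Prod.fst (congrFun key x)

/-- Periodicity of solutions of `u'' = F(u)` with two distinct critical points. -/
theorem stmt_4 (F ubar : ℝ → ℝ) (a b : ℝ) (hab : a ≠ b)
    (hF : ContDiff ℝ 1 F)
    (h1 : Differentiable ℝ ubar)
    (h2 : Differentiable ℝ (deriv ubar))
    (hode : ∀ x, deriv (deriv ubar) x = F (ubar x))
    (ha : deriv ubar a = 0)
    (hb : deriv ubar b = 0) :
    ∀ x : ℝ, ubar (x + 2 * (b - a)) = ubar x := by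
  intro x
  rw [← reflection_eq_of_deriv_eq_zero hF.locallyLipschitz h1 h2 hode ha x,
    ← reflection_eq_of_deriv_eq_zero hF.locallyLipschitz h1 h2 hode hb (2 * a - x)]
  congr 1
  ring
end
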